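/- The set Ψ_n of monomials x_1^{a_1} ⋯ x_n^{a_n} with 0 ≤ a_s < q^{τ(s)} (1 ≤ s ≤ n) is a basis of P as a module over P^{U_I}; that is, P = ⊕_{w ∈ Ψ_n} w · P^{U_I}. Equivalently, the monomial f_I = Π_{s=1}^n x_s^{q^{τ(s)}−1} generates a block basis for the coinvariant algebra P_{U_I}: the set of all monomial factors of f_I projects to an F_q-basis of P/I_{U_I}. -/

import Mathlib

open MvPolynomial Finset

/-- The action of a matrix `g` on `F_q[x_1, …, x_n]`: the algebra map sending
`x_j` to `Σ_i g_{ij} x_i`. -/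
noncomputable def matAct {K : Type*} [Field K] {n : ℕ} (g : Matrix (Fin n) (Fin n) K) :
    MvPolynomial (Fin n) K →ₐ[K] MvPolynomial (Fin n) K :=
  aeval fun j => ∑ i, C (g i j) * X i

/-- The subalgebra of polynomials invariant under every matrix in `G`. -/
noncomputable def invariants {K : Type*} [Field K] {n : ℕ} (G : Set (GL (Fin n) K)) :
    Subalgebra K (MvPolynomial (Fin n) K) where
  carrier := {f | ∀ g ∈ G, matAct ((g : GL (Fin n) K) : Matrix (Fin n) (Fin n) K) f = f}
  mul_mem' := by
    intro a b ha hb g hg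
    rw [map_mul, ha g hg, hb g hg]
  add_mem' := by
    intro a b ha hb g hg
    rw [map_add, ha g hg, hb g hg]
  algebraMap_mem' := by
    intro c g hg
    simp [matAct]

/-- The ideal generated by the homogeneous `G`-invariants of positive degree;
the quotient by it is the algebra of coinvariants. -/
noncomputable def coinvIdeal {K : Type*} [Field K] {n : ℕ} (G : Set (GL (Fin n) K)) :
    Ideal (MvPolynomial (Fin n) K) :=
  Ideal.span {f | f ∈ invariants G ∧ ∃ d, 0 < d ∧ f.IsHomogeneous d}

/-- `tauf m s` is the largest partial sum `m i` which is `≤ s`; for `s` in the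
`(j+1)`-st block this is `m j`. -/
def tauf {l : ℕ} (m : Fin (l + 1) → ℕ) (s : ℕ) : ℕ :=
  ((Finset.univ : Finset (Fin (l + 1))).filter fun i => m i ≤ s).sup m

/-- `U_I`: block upper triangular matrices whose diagonal blocks are identity
matrices (blocks determined by the partial sums `m`). -/
def USet (K : Type*) [Field K] {l : ℕ} (n : ℕ) (m : Fin (l + 1) → ℕ) :
    Set (GL (Fin n) K) :=
  {g | ∀ s t : Fin n, tauf m (t : ℕ) ≤ tauf m (s : ℕ) →
    (g : Matrix (Fin n) (Fin n) K) s t = if s = t then 1 else 0}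

/-- The global index of the `j`-th variable of the `i`-th block. -/
def emb {l : ℕ} (n : ℕ) (m : Fin (l + 1) → ℕ) (hmono : StrictMono m)
    (hlast : m (Fin.last l) = n) (i : Fin l)
    (j : Fin (m i.succ - m i.castSucc)) : Fin n :=
  ⟨m i.castSucc + (j : ℕ), by
    have h1 : m i.succ ≤ n := hlast ▸ hmono.monotone (Fin.le_last _)
    have h2 := j.2
    omega⟩

/-- `G_I`: block upper triangular matrices whose `i`-th diagonal block lies in
`G i` (and whose entries above the diagonal blocks are arbitrary). -/
def GSet (K : Type*) [Field K] {l : ℕ} (n : ℕ) (m : Fin (l + 1) → ℕ)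
    (hmono : StrictMono m) (hlast : m (Fin.last l) = n)
    (G : (i : Fin l) → Subgroup (GL (Fin (m i.succ - m i.castSucc)) K)) :
    Set (GL (Fin n) K) :=
  {g | (∀ s t : Fin n, tauf m (t : ℕ) < tauf m (s : ℕ) →
          (g : Matrix (Fin n) (Fin n) K) s t = 0) ∧
    ∀ i : Fin l, ∃ h ∈ G i, ∀ j k : Fin (m i.succ - m i.castSucc),
      (g : Matrix (Fin n) (Fin n) K) (emb n m hmono hlast i j) (emb n m hmono hlast i k) =
        (h : Matrix (Fin (m i.succ - m i.castSucc)) (Fin (m i.succ - m i.castSucc)) K) j k}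

/-- `Fpoly K k hk t = Π_{(λ_1,…,λ_k) ∈ K^k} (t + λ_1 x_1 + ⋯ + λ_k x_k)`. -/
noncomputable def Fpoly (K : Type*) [Field K] [Fintype K] {n : ℕ} (k : ℕ) (hk : k ≤ n)
    (t : MvPolynomial (Fin n) K) : MvPolynomial (Fin n) K :=
  ∏ c : Fin k → K, (t + ∑ i : Fin k, C (c i) * X (Fin.castLE hk i))

/-- `v_{i,j} = F_{m_{i-1}}(x_{m_{i-1}+j})`. -/
noncomputable def vij (K : Type*) [Field K] [Fintype K] {l : ℕ} (n : ℕ)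
    (m : Fin (l + 1) → ℕ) (hmono : StrictMono m) (hlast : m (Fin.last l) = n)
    (i : Fin l) (j : Fin (m i.succ - m i.castSucc)) : MvPolynomial (Fin n) K :=
  Fpoly K (m i.castSucc)
    (le_trans (hmono.monotone (Fin.le_last _)) (le_of_eq hlast))
    (X (emb n m hmono hlast i j))

lemma tauf_le {l : ℕ} (m : Fin (l + 1) → ℕ) (s : ℕ) : tauf m s ≤ s :=
  Finset.sup_le fun _ hi => (Finset.mem_filter.1 hi).2

lemma lt_tauf_iff {l : ℕ} (m : Fin (l + 1) → ℕ) (s t : ℕ) :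
    s < tauf m t ↔ tauf m s < tauf m t := by
  refine ⟨fun h => (tauf_le m s).trans_lt h, fun h => ?_⟩
  contrapose! h
  refine Finset.sup_le fun j hj => Finset.le_sup (f := m) ?_
  exact Finset.mem_filter.2 ⟨Finset.mem_univ _, (Finset.le_sup (f := m) hj).trans h⟩

/-- The colexicographic monomial order, for which variables of larger index are larger. -/
noncomputable def colexOrder (n : ℕ) : MonomialOrder (Fin n) where
  syn := Colex (Fin n →₀ ℕ)
  toSyn :=
  { toEquiv := toColex
    map_add' := fun _ _ => rfl }
  toSyn_monotone := Finsupp.toColex_monotone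

lemma colexOrder_single_lt {n : ℕ} {i j : Fin n} (h : i < j) :
    (colexOrder n).toSyn (Finsupp.single i 1) < (colexOrder n).toSyn (Finsupp.single j 1) :=
  Finsupp.Colex.single_lt_iff.2 h

section Action

variable {K : Type*} [Field K] {n : ℕ}

lemma matAct_X (g : Matrix (Fin n) (Fin n) K) (j : Fin n) :
    matAct g (X j) = ∑ i, C (g i j) * X i := by
  simp [matAct]

lemma matAct_mul (g h : Matrix (Fin n) (Fin n) K) (f : MvPolynomial (Fin n) K) :
    matAct (g * h) f = matAct g (matAct h f) := by
  suffices H : matAct (g * h) = (matAct g).comp (matAct h) by rw [H]; rfl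
  ext1 j
  simp only [matAct_X, AlgHom.comp_apply, map_sum, map_mul, Matrix.mul_apply, algHom_C,
    algebraMap_eq, Finset.sum_mul, Finset.mul_sum]
  rw [Finset.sum_comm]
  exact Finset.sum_congr rfl fun _ _ => Finset.sum_congr rfl fun _ _ => by ring

lemma matAct_one (f : MvPolynomial (Fin n) K) :
    matAct (1 : Matrix (Fin n) (Fin n) K) f = f := by
  suffices H : matAct (1 : Matrix (Fin n) (Fin n) K) = AlgHom.id K _ by rw [H]; rfl
  ext1 j
  rw [matAct_X, Finset.sum_eq_single j] <;> simp +contextual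

lemma matAct_injective (g : GL (Fin n) K) :
    Function.Injective (matAct (g : Matrix (Fin n) (Fin n) K)) := by
  refine Function.LeftInverse.injective
    (g := matAct ((g⁻¹ : GL (Fin n) K) : Matrix (Fin n) (Fin n) K)) fun f => ?_
  rw [← matAct_mul, ← Units.val_mul, inv_mul_cancel, Units.val_one, matAct_one]

/-- The linear form `x_t + Σ_{i < k} c_i x_i`. -/
noncomputable def shiftedVar (k : ℕ) (t : Fin n) (c : {i : Fin n // (i : ℕ) < k} → K) :
    MvPolynomial (Fin n) K :=
  X t + ∑ i, c i • X i.1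

lemma shiftedVar_injective (k : ℕ) (t : Fin n) :
    Function.Injective (shiftedVar (K := K) k t) := by
  intro c d h
  have hX : LinearIndependent K fun i : {i : Fin n // (i : ℕ) < k} =>
      (X i.1 : MvPolynomial (Fin n) K) :=
    (linearIndependent_X (Fin n) K).comp _ Subtype.val_injective
  exact funext (Fintype.linearIndependent_iffₛ.1 hX c d (add_left_cancel h))

lemma shiftedVar_isHomogeneous (k : ℕ) (t : Fin n) (c : {i : Fin n // (i : ℕ) < k} → K) :
    (shiftedVar k t c).IsHomogeneous 1 := by
  refine (isHomogeneous_X K t).add (IsHomogeneous.sum _ _ _ fun i _ => ?_)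
  rw [smul_eq_C_mul]
  simpa using (isHomogeneous_C (Fin n) (c i)).mul (isHomogeneous_X K i.1)

lemma degree_sum_smul_X_lt {k : ℕ} {t : Fin n} (h : k ≤ t)
    (c : {i : Fin n // (i : ℕ) < k} → K) :
    (colexOrder n).toSyn ((colexOrder n).degree (∑ i, c i • X i.1 : MvPolynomial (Fin n) K)) <
      (colexOrder n).toSyn ((colexOrder n).degree (X t : MvPolynomial (Fin n) K)) := by
  rw [MonomialOrder.degree_X]
  refine MonomialOrder.degree_sum_le.trans_lt ((Finset.sup_lt_iff ?_).2 fun i _ => ?_)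
  · rw [MonomialOrder.bot_eq_zero, MonomialOrder.toSyn_lt_iff_ne_zero, Ne,
      MonomialOrder.toSyn_eq_zero_iff]
    simp
  · refine MonomialOrder.degree_smul_le.trans_lt ?_
    rw [MonomialOrder.degree_X]
    exact colexOrder_single_lt (Fin.lt_def.2 (i.2.trans_le h))

lemma degree_shiftedVar {k : ℕ} {t : Fin n} (h : k ≤ t)
    (c : {i : Fin n // (i : ℕ) < k} → K) :
    (colexOrder n).degree (shiftedVar k t c) = Finsupp.single t 1 := by
  rw [shiftedVar, MonomialOrder.degree_add_of_lt (degree_sum_smul_X_lt h c),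
    MonomialOrder.degree_X]

lemma monic_shiftedVar {k : ℕ} {t : Fin n} (h : k ≤ t)
    (c : {i : Fin n // (i : ℕ) < k} → K) :
    (colexOrder n).Monic (shiftedVar k t c) :=
  MonomialOrder.monic_X.add_of_lt (degree_sum_smul_X_lt h c)

omit [Field K] in
lemma card_val_lt_fun [Fintype K] {k : ℕ} (h : k ≤ n) :
    Fintype.card ({i : Fin n // (i : ℕ) < k} → K) = Fintype.card K ^ k := by
  rw [Fintype.card_fun, Fintype.card_subtype, Fin.card_filter_val_lt, min_eq_right h]

/-- The product of all linear forms `x_t + Σ_{i < k} c_i x_i`. -/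
noncomputable def orbitProd [Fintype K] (k : ℕ) (t : Fin n) : MvPolynomial (Fin n) K :=
  ∏ c : {i : Fin n // (i : ℕ) < k} → K, shiftedVar k t c

lemma orbitProd_isHomogeneous [Fintype K] {k : ℕ} (t : Fin n) (h : k ≤ n) :
    (orbitProd (K := K) k t).IsHomogeneous (Fintype.card K ^ k) := by
  have := IsHomogeneous.prod Finset.univ (shiftedVar (K := K) k t) (fun _ => 1)
    fun c _ => shiftedVar_isHomogeneous k t c
  rwa [Finset.sum_const, Finset.card_univ, card_val_lt_fun h, smul_eq_mul, mul_one] at this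

lemma monic_orbitProd [Fintype K] {k : ℕ} {t : Fin n} (h : k ≤ t) :
    (colexOrder n).Monic (orbitProd (K := K) k t) :=
  MonomialOrder.Monic.prod fun c _ => monic_shiftedVar h c

lemma degree_orbitProd [Fintype K] {k : ℕ} {t : Fin n} (h : k ≤ t) :
    (colexOrder n).degree (orbitProd (K := K) k t) =
      Finsupp.single t (Fintype.card K ^ k) := by
  rw [orbitProd, MonomialOrder.degree_prod fun c _ => (monic_shiftedVar h c).ne_zero,
    Finset.sum_congr rfl fun c _ => degree_shiftedVar h c, Finset.sum_const, Finset.card_univ,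
    card_val_lt_fun (h.trans t.2.le), Finsupp.smul_single, smul_eq_mul, mul_one]

/-- A subspace of polynomials containing the monomials with `a_s < d_s` and stable under
multiplication by polynomials `v_s` with leading monomial `x_s ^ d_s` is everything. -/
lemma eq_top_of_monomials_of_mul_mem (o : MonomialOrder (Fin n)) (d : Fin n → ℕ)
    (hd : ∀ s, d s ≠ 0) (v : Fin n → MvPolynomial (Fin n) K) (hv : ∀ s, o.Monic (v s))
    (hdeg : ∀ s, o.degree (v s) = Finsupp.single s (d s))
    (N : Submodule K (MvPolynomial (Fin n) K))
    (hmon : ∀ a : Fin n → ℕ, (∀ s, a s < d s) → ∏ s, X s ^ a s ∈ N)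
    (hmul : ∀ s, ∀ f ∈ N, v s * f ∈ N) : N = ⊤ := by
  refine Submodule.eq_top_iff'.2 fun f => ?_
  induction hf : o.toSyn (o.degree f) using WellFoundedLT.induction generalizing f with
  | ind x ih =>
  subst hf
  obtain ⟨g, r, hfgr, hg, hr⟩ := o.div (b := v)
    (fun i => by rw [(hv i).leadingCoeff_eq_one]; exact isUnit_one) f
  have hgN : ∀ i, g i ∈ N := by
    intro i
    by_cases h0 : g i = 0
    · rw [h0]; exact N.zero_mem
    refine ih _ (lt_of_lt_of_le ?_ (hg i)) _ rfl
    rw [MonomialOrder.degree_mul (hv i).ne_zero h0, map_add, lt_add_iff_pos_left,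
      MonomialOrder.toSyn_lt_iff_ne_zero, Ne, MonomialOrder.toSyn_eq_zero_iff, hdeg]
    simpa using hd i
  rw [hfgr]
  refine N.add_mem ?_ ?_
  · rw [Finsupp.linearCombination_apply, Finsupp.sum]
    refine N.sum_mem fun i _ => ?_
    rw [smul_eq_mul, mul_comm]
    exact hmul i _ (hgN i)
  · rw [r.as_sum]
    refine N.sum_mem fun c hc => ?_
    rw [← mul_one (coeff c r), ← smul_eq_mul, ← smul_monomial]
    refine N.smul_mem _ ?_
    have := hmon c fun s => by
      have := hr c hc s
      rw [hdeg, Finsupp.single_le_iff] at this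
      exact not_le.1 this
    rwa [monomial_eq, C_1, one_mul, Finsupp.prod_fintype _ _ fun _ => pow_zero _]

end Action

section Unipotent

variable {K : Type*} [Field K] {n l : ℕ} {m : Fin (l + 1) → ℕ}

/-- The span of the variables `x_i` with `i < k`. -/
noncomputable def varSpan (K : Type*) [Field K] (n k : ℕ) :
    Submodule K (MvPolynomial (Fin n) K) :=
  Submodule.span K (Set.range fun i : {i : Fin n // (i : ℕ) < k} => X i.1)

lemma X_mem_varSpan {k : ℕ} {i : Fin n} (h : (i : ℕ) < k) : X i ∈ varSpan K n k :=
  Submodule.subset_span ⟨⟨i, h⟩, rfl⟩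

lemma varSpan_mono {k k' : ℕ} (h : k ≤ k') : varSpan K n k ≤ varSpan K n k' := by
  refine Submodule.span_le.2 ?_
  rintro _ ⟨i, rfl⟩
  exact X_mem_varSpan (i.2.trans_le h)

lemma matAct_X_sub_mem {g : GL (Fin n) K} (hg : g ∈ USet K n m) (t : Fin n) :
    matAct (g : Matrix (Fin n) (Fin n) K) (X t) - X t ∈ varSpan K n (tauf m t) := by
  have h : matAct (g : Matrix (Fin n) (Fin n) K) (X t) - X t =
      ∑ s, ((g : Matrix (Fin n) (Fin n) K) s t - (1 : Matrix (Fin n) (Fin n) K) s t) •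
        (X s : MvPolynomial (Fin n) K) := by
    nth_rw 2 [← matAct_one (X t)]
    rw [matAct_X, matAct_X, ← Finset.sum_sub_distrib]
    exact Finset.sum_congr rfl fun s _ => by rw [smul_eq_C_mul, C_sub, sub_mul]
  rw [h]
  refine Submodule.sum_mem _ fun s _ => ?_
  by_cases hs : (s : ℕ) < tauf m t
  · exact Submodule.smul_mem _ _ (X_mem_varSpan hs)
  · rw [hg s t (not_lt.1 ((lt_tauf_iff m s t).not.1 hs)), Matrix.one_apply, sub_self, zero_smul]
    exact Submodule.zero_mem _

lemma matAct_X_mem {g : GL (Fin n) K} (hg : g ∈ USet K n m) {t : ℕ} {i : Fin n}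
    (h : (i : ℕ) < tauf m t) :
    matAct (g : Matrix (Fin n) (Fin n) K) (X i) ∈ varSpan K n (tauf m t) := by
  rw [← sub_add_cancel (matAct (g : Matrix (Fin n) (Fin n) K) (X i)) (X i)]
  exact Submodule.add_mem _
    (varSpan_mono ((tauf_le m i).trans h.le) (matAct_X_sub_mem hg i)) (X_mem_varSpan h)

lemma exists_matAct_shiftedVar {g : GL (Fin n) K} (hg : g ∈ USet K n m) (t : Fin n)
    (c : {i : Fin n // (i : ℕ) < tauf m t} → K) :
    ∃ c', matAct (g : Matrix (Fin n) (Fin n) K) (shiftedVar (tauf m t) t c) =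
      shiftedVar (tauf m t) t c' := by
  have hmem : (matAct (g : Matrix (Fin n) (Fin n) K) (X t) - X t) +
      ∑ i, c i • matAct (g : Matrix (Fin n) (Fin n) K) (X i.1) ∈ varSpan K n (tauf m t) :=
    Submodule.add_mem _ (matAct_X_sub_mem hg t)
      (Submodule.sum_mem _ fun i _ => Submodule.smul_mem _ _ (matAct_X_mem hg i.2))
  obtain ⟨c', hc'⟩ := (Submodule.mem_span_range_iff_exists_fun K).1 hmem
  refine ⟨c', ?_⟩
  rw [shiftedVar, shiftedVar, hc', map_add, map_sum]
  simp only [map_smul]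
  ring

lemma orbitProd_mem_invariants [Fintype K] (t : Fin n) :
    orbitProd (tauf m t) t ∈ invariants (USet K n m) := by
  intro g hg
  choose φ hφ using exists_matAct_shiftedVar (m := m) hg t
  have hinj : Function.Injective φ := fun c d h =>
    shiftedVar_injective _ t (matAct_injective g (by rw [hφ, hφ, h]))
  rw [orbitProd, map_prod]
  exact Fintype.prod_bijective φ (Finite.injective_iff_bijective.1 hinj) _ _ hφ

lemma exists_mem_USet_matAct_X
    (c : ∀ t : Fin n, {i : Fin n // (i : ℕ) < tauf m t} → K) :
    ∃ g ∈ USet K n m, ∀ t, matAct (g : Matrix (Fin n) (Fin n) K) (X t) =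
      shiftedVar (tauf m t) t (c t) := by
  let M : Matrix (Fin n) (Fin n) K := Matrix.of fun s t =>
    (if s = t then 1 else 0) + if h : (s : ℕ) < tauf m t then c t ⟨s, h⟩ else 0
  have hM : ∀ s t : Fin n, ¬ (s : ℕ) < tauf m t → M s t = if s = t then 1 else 0 := by
    intro s t h
    simp [M, h]
  have hdet : M.det ≠ 0 := by
    rw [Matrix.det_of_isUpperTriangular]
    · simp [hM _ _ (tauf_le m _).not_gt]
    · intro s t (hts : t < s)
      rw [hM _ _ (((tauf_le m t).trans (Fin.lt_def.1 hts).le).not_gt), if_neg hts.ne']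
  refine ⟨Matrix.GeneralLinearGroup.mkOfDetNeZero M hdet, fun s t h => ?_, fun t => ?_⟩
  · exact hM s t ((lt_tauf_iff m s t).not.2 h.not_gt)
  · change matAct M (X t) = _
    simp only [matAct_X, M, Matrix.of_apply, C_add, add_mul, Finset.sum_add_distrib, shiftedVar]
    congr 1
    · simp
    · refine (Fintype.sum_of_injective _ Subtype.val_injective _ _ (fun s hs => ?_)
        fun s => ?_).symm
      · rw [dif_neg fun h => hs ⟨⟨s, h⟩, rfl⟩, C_0, zero_mul]
      · rw [dif_pos s.2, smul_eq_C_mul]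

/-- Monomials of degree less than `q ^ τ(s)` in each `x_s` are independent over the invariants:
by invariance, a relation holds on the whole grid of orbits of the variables. -/
lemma linearIndependent_monomials [Fintype K] :
    LinearIndependent (invariants (USet K n m))
      (fun a : {a : Fin n → ℕ // ∀ s : Fin n, a s < Fintype.card K ^ tauf m (s : ℕ)} =>
        (∏ s : Fin n, X s ^ a.1 s : MvPolynomial (Fin n) K)) := by
  classical
  rw [linearIndependent_iff']
  intro S g hg a ha
  let e (b : {a : Fin n → ℕ // ∀ s : Fin n, a s < Fintype.card K ^ tauf m (s : ℕ)}) :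
    Fin n →₀ ℕ := Finsupp.equivFunOnFinite.symm b.1
  have he : Function.Injective e :=
    Finsupp.equivFunOnFinite.symm.injective.comp Subtype.val_injective
  let F : MvPolynomial (Fin n) (MvPolynomial (Fin n) K) :=
    ∑ b ∈ S, monomial (e b) (g b : MvPolynomial (Fin n) K)
  have hF : F = 0 := by
    refine eq_zero_of_eval_zero_at_prod_finset F
      (fun t => Finset.univ.image (shiftedVar (tauf m t) t)) (fun t => ?_) fun x hx => ?_
    · rw [Finset.card_image_of_injective _ (shiftedVar_injective _ t), Finset.card_univ,
        card_val_lt_fun ((tauf_le m t).trans t.2.le)]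
      have hpos : 0 < Fintype.card K ^ tauf m (t : ℕ) := pow_pos Fintype.card_pos _
      refine (degreeOf_sum_le _ _ _).trans_lt ((Finset.sup_lt_iff hpos).2 fun b _ => ?_)
      by_cases h0 : (g b : MvPolynomial (Fin n) K) = 0
      · simpa [h0] using hpos
      · rw [degreeOf_monomial_eq _ _ h0]
        exact b.2 t
    · choose c hc using fun t => Finset.mem_image.1 (hx t)
      obtain ⟨γ, hγ, hγX⟩ := exists_mem_USet_matAct_X (m := m) c
      have := congrArg (matAct (γ : Matrix (Fin n) (Fin n) K)) hg
      rw [map_zero, map_sum] at this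
      rw [← this, map_sum]
      refine Finset.sum_congr rfl fun b _ => ?_
      rw [eval_monomial, Finsupp.prod_fintype _ _ fun _ => pow_zero _, Algebra.smul_def,
        map_mul, map_prod]
      congr 1
      · exact ((g b).2 γ hγ).symm
      · exact Finset.prod_congr rfl fun t _ => by rw [map_pow, hγX, (hc t).2]; rfl
  have hcoeff : coeff (e a) F = g a := by
    simp only [F, coeff_sum, coeff_monomial, he.eq_iff]
    rw [Finset.sum_ite_eq' S a, if_pos ha]
  rw [hF, coeff_zero] at hcoeff
  exact Subtype.ext hcoeff.symm

lemma eq_top_of_orbitProd_mul_mem [Fintype K] (N : Submodule K (MvPolynomial (Fin n) K))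
    (hmon : ∀ a : Fin n → ℕ, (∀ s : Fin n, a s < Fintype.card K ^ tauf m (s : ℕ)) →
      ∏ s, X s ^ a s ∈ N)
    (hmul : ∀ t : Fin n, ∀ f ∈ N, orbitProd (tauf m t) t * f ∈ N) : N = ⊤ :=
  eq_top_of_monomials_of_mul_mem (colexOrder n) _
    (fun _ => (pow_pos Fintype.card_pos _).ne') _ (fun t => monic_orbitProd (tauf_le m t))
    (fun t => degree_orbitProd (tauf_le m t)) N hmon hmul

lemma span_monomials_eq_top [Fintype K] :
    Submodule.span (invariants (USet K n m))
      (Set.range (fun a : {a : Fin n → ℕ //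
          ∀ s : Fin n, a s < Fintype.card K ^ tauf m (s : ℕ)} =>
        (∏ s : Fin n, X s ^ a.1 s : MvPolynomial (Fin n) K))) = ⊤ := by
  rw [← Submodule.restrictScalars_eq_top_iff K]
  refine eq_top_of_orbitProd_mul_mem (m := m) _ (fun a ha => ?_) fun t f hf => ?_
  · exact Submodule.subset_span ⟨⟨a, ha⟩, rfl⟩
  · exact Submodule.smul_mem _
      (⟨_, orbitProd_mem_invariants t⟩ : invariants (USet K n m)) hf

lemma orbitProd_mem_coinvIdeal [Fintype K] (t : Fin n) :
    orbitProd (tauf m t) t ∈ coinvIdeal (USet K n m) :=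
  Ideal.subset_span ⟨orbitProd_mem_invariants t, _, pow_pos Fintype.card_pos _,
    orbitProd_isHomogeneous t ((tauf_le m t).trans t.2.le)⟩

lemma span_mk_monomials_eq_top [Fintype K] :
    Submodule.span K
      (Set.range (fun a : {a : Fin n → ℕ //
          ∀ s : Fin n, a s < Fintype.card K ^ tauf m (s : ℕ)} =>
        Ideal.Quotient.mk (coinvIdeal (USet K n m)) (∏ s : Fin n, X s ^ a.1 s))) = ⊤ := by
  set N := Submodule.span K
      (Set.range (fun a : {a : Fin n → ℕ //
          ∀ s : Fin n, a s < Fintype.card K ^ tauf m (s : ℕ)} =>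
        Ideal.Quotient.mk (coinvIdeal (USet K n m)) (∏ s : Fin n, X s ^ a.1 s))) with hN
  have h : N.comap (Ideal.Quotient.mkₐ K (coinvIdeal (USet K n m))).toLinearMap = ⊤ := by
    refine eq_top_of_orbitProd_mul_mem (m := m) _ (fun a ha => ?_) fun t f _ => ?_
    · exact Submodule.subset_span ⟨⟨a, ha⟩, rfl⟩
    · have : Ideal.Quotient.mk (coinvIdeal (USet K n m)) (orbitProd (tauf m t) t * f) = 0 :=
        Ideal.Quotient.eq_zero_iff_mem.2 (Ideal.mul_mem_right _ _ (orbitProd_mem_coinvIdeal t))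
      rw [Submodule.mem_comap]
      change Ideal.Quotient.mk _ _ ∈ N
      rw [this]
      exact N.zero_mem
  refine Submodule.eq_top_iff'.2 fun y => ?_
  obtain ⟨f, rfl⟩ := Ideal.Quotient.mk_surjective y
  exact Submodule.eq_top_iff'.1 h f

end Unipotent

/-- If `P` is free over the invariants of `G`, a basis stays independent in the coinvariants. -/
lemma linearIndependent_mk_of_basis {K : Type*} [Field K] {n : ℕ} {G : Set (GL (Fin n) K)}
    {ι : Type*} (b : Module.Basis ι (invariants G) (MvPolynomial (Fin n) K)) :
    LinearIndependent K fun i => Ideal.Quotient.mk (coinvIdeal G) (b i) := by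
  classical
  have hI : ∀ f ∈ coinvIdeal G, ∀ i, constantCoeff (b.repr f i : MvPolynomial (Fin n) K) = 0 := by
    intro f hf i
    obtain ⟨k, u, x, rfl⟩ := Submodule.mem_span_set'.1 hf
    rw [map_sum, Finsupp.finsetSum_apply, AddSubmonoidClass.coe_finsetSum, map_sum]
    refine Finset.sum_eq_zero fun j _ => ?_
    obtain ⟨hx, d, hd, hxd⟩ := (x j).2
    have h1 : u j • (x j : MvPolynomial (Fin n) K) =
        (⟨x j, hx⟩ : invariants G) • u j := by
      rw [smul_eq_mul, mul_comm]; rfl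
    rw [h1, map_smul, Finsupp.smul_apply, smul_eq_mul, MulMemClass.coe_mul, map_mul,
      constantCoeff_eq, hxd.coeff_eq_zero (by simpa using hd.ne), zero_mul]
  rw [linearIndependent_iff']
  intro S c hc i hi
  have hmem : ∑ j ∈ S, algebraMap K (invariants G) (c j) • b j ∈ coinvIdeal G := by
    rw [← Ideal.Quotient.eq_zero_iff_mem, ← hc, map_sum]
    refine Finset.sum_congr rfl fun j _ => ?_
    rw [algebraMap_smul]
    rfl
  have := hI _ hmem i
  simp only [map_sum, map_smul, b.repr_self, Finsupp.finsetSum_apply, Finsupp.smul_apply,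
    Finsupp.single_apply, smul_eq_mul, mul_ite, mul_one, mul_zero] at this
  rw [Finset.sum_ite_eq' S i, if_pos hi] at this
  simpa using this

/-- the set `Ψ_n` of monomials `x_1^{a_1} ⋯ x_n^{a_n}` with
`0 ≤ a_s < q^{τ(s)}` is a basis of `P` as a module over `P^{U_I}` (linearly
independent over `P^{U_I}` and spanning).  Equivalently, the monomial
`f_I = Π_s x_s^{q^{τ(s)}-1}` generates a block basis for the coinvariant algebra
`P_{U_I}`: its monomial factors project to an `F_q`-basis of `P/I_{U_I}`. -/
theorem statement11 {K : Type*} [Field K] [Fintype K] {p r : ℕ} (hp : p.Prime)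
    (hr : 0 < r) (hcard : Fintype.card K = p ^ r)
    (n l : ℕ) (hl : 0 < l) (m : Fin (l + 1) → ℕ)
    (hm0 : m 0 = 0) (hmono : StrictMono m) (hlast : m (Fin.last l) = n) :
    (LinearIndependent (invariants (USet K n m))
      (fun a : {a : Fin n → ℕ // ∀ s : Fin n, a s < Fintype.card K ^ tauf m (s : ℕ)} =>
        (∏ s : Fin n, X s ^ a.1 s : MvPolynomial (Fin n) K)) ∧
     Submodule.span (invariants (USet K n m))
      (Set.range (fun a : {a : Fin n → ℕ //
          ∀ s : Fin n, a s < Fintype.card K ^ tauf m (s : ℕ)} =>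
        (∏ s : Fin n, X s ^ a.1 s : MvPolynomial (Fin n) K))) = ⊤) ∧
    (LinearIndependent K
      (fun a : {a : Fin n → ℕ // ∀ s : Fin n, a s < Fintype.card K ^ tauf m (s : ℕ)} =>
        Ideal.Quotient.mk (coinvIdeal (USet K n m)) (∏ s : Fin n, X s ^ a.1 s)) ∧
     Submodule.span K
      (Set.range (fun a : {a : Fin n → ℕ //
          ∀ s : Fin n, a s < Fintype.card K ^ tauf m (s : ℕ)} =>
        Ideal.Quotient.mk (coinvIdeal (USet K n m)) (∏ s : Fin n, X s ^ a.1 s))) = ⊤) := by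
  refine ⟨⟨linearIndependent_monomials, span_monomials_eq_top⟩, ?_, span_mk_monomials_eq_top⟩
  simpa using linearIndependent_mk_of_basis
    (Module.Basis.mk (linearIndependent_monomials (K := K) (n := n) (m := m))
      span_monomials_eq_top.ge)
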